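/- arXiv:2408.16416 — 2 statements merged into one kernel-verified Lean document; each statement's English description precedes it below -/
import Mathlib

section
/- Let E be an m×m real symmetric positive definite matrix and D an n×n real symmetric positive definite matrix. Then every matrix Z ∈ ℝ^{m×n} admits a weighted singular value decomposition Z = Ũ Σ̃ Ṽᵀ, where Ũ ∈ ℝ^{m×m} satisfies Ũᵀ E Ũ = I_m, Ṽ ∈ ℝ^{n×n} satisfies Ṽᵀ D Ṽ = I_n, and Σ̃ ∈ ℝ^{m×n} is diagonal with nonnegative, nonincreasing diagonal entries σ̃₁ ≥ σ̃₂ ≥ ⋯ ≥ σ̃_{min(m,n)} ≥ 0. -/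
open Matrix

/-- **Singular value decomposition** of a linear map between finite-dimensional inner product
spaces, in terms of orthonormal bases. -/
theorem LinearMap.exists_orthonormalBasis_inner_eq_singularValues {𝕜 E F : Type*} [RCLike 𝕜]
    [NormedAddCommGroup E] [InnerProductSpace 𝕜 E] [FiniteDimensional 𝕜 E]
    [NormedAddCommGroup F] [InnerProductSpace 𝕜 F] [FiniteDimensional 𝕜 F]
    (T : E →ₗ[𝕜] F) {m n : ℕ} (hm : Module.finrank 𝕜 F = m) (hn : Module.finrank 𝕜 E = n) :
    ∃ (u : OrthonormalBasis (Fin m) 𝕜 F) (v : OrthonormalBasis (Fin n) 𝕜 E),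
      ∀ i j, inner 𝕜 (u i) (T (v j)) =
        if (i : ℕ) = (j : ℕ) then (T.singularValues j : 𝕜) else 0 := by
  set v := T.isSymmetric_adjoint_comp_self.eigenvectorBasis hn
  have inner_T (i j : Fin n) : inner 𝕜 (T (v i)) (T (v j)) =
      if i = j then (T.singularValues j : 𝕜) ^ 2 else 0 := by
    have hv : (adjoint T) (T (v j)) = ((T.singularValues j ^ 2 : ℝ) : 𝕜) • v j := by
      rw [T.sq_singularValues_fin hn]
      exact T.isSymmetric_adjoint_comp_self.apply_eigenvectorBasis hn j
    rw [← adjoint_inner_right, hv, inner_smul_right, v.inner_eq_ite]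
    simp
  have lt_n {k : ℕ} (hk : T.singularValues k ≠ 0) : k < n := by
    by_contra! h
    exact hk (T.singularValues_of_finrank_le (hn.trans_le h))
  have lt_m {k : ℕ} (hk : T.singularValues k ≠ 0) : k < m := by
    rw [← T.singularValues_pos_iff_ne_zero, T.singularValues_pos_iff_lt_finrank_range] at hk
    exact hk.trans_le ((Submodule.finrank_le _).trans_eq hm)
  let w (i : Fin m) : F :=
    if h : (i : ℕ) < n then ((T.singularValues i : 𝕜)⁻¹) • T (v ⟨i, h⟩) else 0
  let s : Set (Fin m) := {i | T.singularValues i ≠ 0}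
  have hw : Orthonormal 𝕜 (s.domRestrict w) := by
    rw [orthonormal_iff_ite]
    rintro ⟨i, hi⟩ ⟨j, hj⟩
    have hi' : (T.singularValues i : 𝕜) ≠ 0 := by exact_mod_cast hi
    simp only [Set.domRestrict_apply, w, dif_pos (lt_n hi), dif_pos (lt_n hj), inner_smul_left,
      inner_smul_right, inner_T, Subtype.mk.injEq, Fin.ext_iff]
    split_ifs with h
    · rw [← h]
      simp
      field_simp
    · simp
  obtain ⟨u, hu⟩ := hw.exists_orthonormalBasis_extension_of_card_eq (by simpa using hm)
  refine ⟨u, v, fun i j ↦ ?_⟩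
  by_cases hj : T.singularValues j = 0
  · have : T (v j) = 0 := by
      rw [← inner_self_eq_zero (𝕜 := 𝕜), inner_T]
      simp [hj]
    simp [this, hj]
  · have hj' : (T.singularValues j : 𝕜) ≠ 0 := by exact_mod_cast hj
    have hTv : T (v j) = (T.singularValues j : 𝕜) • u ⟨j, lt_m hj⟩ := by
      rw [hu ⟨j, lt_m hj⟩ hj]
      simp [w, smul_smul, hj']
    rw [hTv, inner_smul_right, u.inner_eq_ite]
    simp [Fin.ext_iff]

/-- **Singular value decomposition** of a matrix. -/
theorem Matrix.exists_svd {𝕜 : Type*} [RCLike 𝕜] {m n : ℕ} (A : Matrix (Fin m) (Fin n) 𝕜) :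
    ∃ P ∈ unitaryGroup (Fin m) 𝕜, ∃ Q ∈ unitaryGroup (Fin n) 𝕜,
      A = P * of (fun (i : Fin m) (j : Fin n) ↦ if (i : ℕ) = (j : ℕ) then
        ((toEuclideanLin A).singularValues j : 𝕜) else 0) * Qᴴ := by
  obtain ⟨u, v, huv⟩ := (toEuclideanLin A).exists_orthonormalBasis_inner_eq_singularValues
    finrank_euclideanSpace_fin finrank_euclideanSpace_fin
  set P := (EuclideanSpace.basisFun (Fin m) 𝕜).toBasis.toMatrix u
  set Q := (EuclideanSpace.basisFun (Fin n) 𝕜).toBasis.toMatrix v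
  have hP : P ∈ unitaryGroup (Fin m) 𝕜 :=
    (EuclideanSpace.basisFun (Fin m) 𝕜).toMatrix_orthonormalBasis_mem_unitary u
  have hQ : Q ∈ unitaryGroup (Fin n) 𝕜 :=
    (EuclideanSpace.basisFun (Fin n) 𝕜).toMatrix_orthonormalBasis_mem_unitary v
  refine ⟨P, hP, Q, hQ, ?_⟩
  have key : of (fun (i : Fin m) (j : Fin n) ↦ if (i : ℕ) = (j : ℕ) then
      ((toEuclideanLin A).singularValues j : 𝕜) else 0) = Pᴴ * A * Q := by
    ext i j
    rw [of_apply, ← huv, Matrix.mul_assoc, Matrix.mul_apply, PiLp.inner_apply]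
    refine Finset.sum_congr rfl fun k _ ↦ ?_
    simp [P, Q, Module.Basis.toMatrix_apply, Matrix.mul_apply, mulVec, dotProduct, mul_comm]
  rw [mem_unitaryGroup_iff, star_eq_conjTranspose] at hP hQ
  rw [key, Matrix.mul_assoc Pᴴ, ← Matrix.mul_assoc P, hP, Matrix.one_mul, Matrix.mul_assoc, hQ,
    Matrix.mul_one]

open scoped ComplexOrder MatrixOrder Matrix.Norms.L2Operator in
theorem Matrix.PosDef.exists_isUnit_eq_conjTranspose_mul_self {𝕜 n : Type*} [RCLike 𝕜] [Fintype n]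
    [DecidableEq n] {A : Matrix n n 𝕜} (hA : A.PosDef) :
    ∃ B : Matrix n n 𝕜, IsUnit B ∧ A = Bᴴ * B :=
  CStarAlgebra.isStrictlyPositive_iff_eq_star_mul_self.mp hA.isStrictlyPositive

/-- Every real matrix admits a weighted singular value decomposition with respect to
SPD weight matrices `E` and `D`. -/
theorem weighted_svd_exists (m n : ℕ)
    (E : Matrix (Fin m) (Fin m) ℝ) (D : Matrix (Fin n) (Fin n) ℝ)
    (hE : E.PosDef) (hD : D.PosDef)
    (Z : Matrix (Fin m) (Fin n) ℝ) :
    ∃ (U : Matrix (Fin m) (Fin m) ℝ) (V : Matrix (Fin n) (Fin n) ℝ)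
      (S : Matrix (Fin m) (Fin n) ℝ),
      Uᵀ * E * U = 1 ∧ Vᵀ * D * V = 1 ∧
      (∀ (i : Fin m) (j : Fin n), (i : ℕ) ≠ (j : ℕ) → S i j = 0) ∧
      (∀ (i : Fin m) (j : Fin n), (i : ℕ) = (j : ℕ) → 0 ≤ S i j) ∧
      (∀ (i i' : Fin m) (j j' : Fin n), (i : ℕ) = (j : ℕ) → (i' : ℕ) = (j' : ℕ) →
        (i : ℕ) ≤ (i' : ℕ) → S i' j' ≤ S i j) ∧
      Z = U * S * Vᵀ := by
  have weight {k : ℕ} {B P : Matrix (Fin k) (Fin k) ℝ} (hB : IsUnit B.det)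
      (hP : P ∈ unitaryGroup (Fin k) ℝ) : (B⁻¹ * P)ᵀ * (Bᵀ * B) * (B⁻¹ * P) = 1 := by
    have h : B * (B⁻¹ * P) = P := mul_nonsing_inv_cancel_left B P hB
    rw [Matrix.mul_assoc, Matrix.mul_assoc Bᵀ, h, ← Matrix.mul_assoc, ← transpose_mul, h]
    simpa [star_eq_conjTranspose] using mem_unitaryGroup_iff'.mp hP
  obtain ⟨B, hB, rfl⟩ := hE.exists_isUnit_eq_conjTranspose_mul_self
  obtain ⟨C, hC, rfl⟩ := hD.exists_isUnit_eq_conjTranspose_mul_self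
  rw [isUnit_iff_isUnit_det] at hB hC
  obtain ⟨P, hP, Q, hQ, h⟩ := (B * Z * Cᵀ).exists_svd
  set S : Matrix (Fin m) (Fin n) ℝ := of _ with hS
  refine ⟨B⁻¹ * P, C⁻¹ * Q, S, weight hB hP, weight hC hQ, fun i j hij ↦ ?_, fun i j hij ↦ ?_,
    fun i i' j j' hij hij' hii' ↦ ?_, ?_⟩
  · simp [hS, hij]
  · simpa [hS, hij] using LinearMap.singularValues_nonneg _ _
  · simpa [hS, hij, hij'] using LinearMap.singularValues_antitone _ (by lia)
  · have hCt : IsUnit Cᵀ.det := by rwa [det_transpose]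
    calc Z = B⁻¹ * (B * Z * Cᵀ) * Cᵀ⁻¹ := by
          rw [Matrix.mul_assoc B, nonsing_inv_mul_cancel_left _ _ hB,
            mul_nonsing_inv_cancel_right _ _ hCt]
      _ = _ := by
          rw [h, transpose_mul, transpose_nonsing_inv]
          simp [Matrix.mul_assoc]
end

section
/- Let A ∈ ℝ^{m×m} be symmetric and λ ∈ ℝ be such that A + λI_m is positive definite, and let U ∈ ℝ^{m×r} satisfy UᵀU = I_r. Define S = −Uᵀ(A + λI_m)⁻¹U (which is invertible, being negative definite) and L = (I_m + (A + λI_m)⁻¹ U S⁻¹ Uᵀ)(A + λI_m)⁻¹. If u ∈ ℝ^m satisfies (I_m − UUᵀ) A u + λ u = b and Uᵀ u = 0, then u = L b. -/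
open Matrix

/-- Explicit solution of the projected shifted linear system: if
`(I − UUᵀ) A u + λ u = b` with `Uᵀ u = 0`, then `u = L b` where
`L = (I + (A + λI)⁻¹ U S⁻¹ Uᵀ)(A + λI)⁻¹` and `S = −Uᵀ (A + λI)⁻¹ U`. -/
theorem projected_shifted_system_solution (m r : ℕ)
    (A : Matrix (Fin m) (Fin m) ℝ) (hA : Aᵀ = A) (lam : ℝ)
    (hpos : (A + lam • (1 : Matrix (Fin m) (Fin m) ℝ)).PosDef)
    (U : Matrix (Fin m) (Fin r) ℝ) (hU : Uᵀ * U = 1)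
    (S : Matrix (Fin r) (Fin r) ℝ)
    (hS : S = -(Uᵀ * (A + lam • (1 : Matrix (Fin m) (Fin m) ℝ))⁻¹ * U))
    (L : Matrix (Fin m) (Fin m) ℝ)
    (hL : L = (1 + (A + lam • (1 : Matrix (Fin m) (Fin m) ℝ))⁻¹ * U * S⁻¹ * Uᵀ)
        * (A + lam • (1 : Matrix (Fin m) (Fin m) ℝ))⁻¹)
    (u b : Fin m → ℝ)
    (hu : (1 - U * Uᵀ) *ᵥ (A *ᵥ u) + lam • u = b)
    (horth : Uᵀ *ᵥ u = 0) :
    u = L *ᵥ b := by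
  set M := A + lam • (1 : Matrix (Fin m) (Fin m) ℝ) with hM
  have hinj : Function.Injective U.mulVec :=
    Function.LeftInverse.injective (g := Uᵀ.mulVec) fun x => by
      rw [mulVec_mulVec, hU, one_mulVec]
  have hSdet : IsUnit S.det := by
    rw [← isUnit_iff_isUnit_det, hS, IsUnit.neg_iff, ← conjTranspose_eq_transpose_of_trivial]
    exact (hpos.inv.conjTranspose_mul_mul_same hinj).isUnit
  have hMdet : IsUnit M.det := (isUnit_iff_isUnit_det M).mp hpos.isUnit
  have hMu : M *ᵥ u = b + U *ᵥ (Uᵀ *ᵥ (A *ᵥ u)) := by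
    rw [← hu, hM, add_mulVec, smul_mulVec, one_mulVec, sub_mulVec, one_mulVec, ← mulVec_mulVec]
    abel
  set w := Uᵀ *ᵥ (A *ᵥ u)
  have hu_eq : u = M⁻¹ *ᵥ b + M⁻¹ *ᵥ (U *ᵥ w) := by
    rw [← mulVec_add, ← hMu, mulVec_mulVec, nonsing_inv_mul _ hMdet, one_mulVec]
  have hSw : S *ᵥ w = Uᵀ *ᵥ (M⁻¹ *ᵥ b) := by
    rw [hu_eq, mulVec_add] at horth
    rw [hS, neg_mulVec, ← mulVec_mulVec, ← mulVec_mulVec]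
    exact (eq_neg_of_add_eq_zero_left horth).symm
  have hw : w = S⁻¹ *ᵥ (Uᵀ *ᵥ (M⁻¹ *ᵥ b)) := by
    rw [← hSw, mulVec_mulVec, nonsing_inv_mul _ hSdet, one_mulVec]
  rw [hw] at hu_eq
  rw [hL]
  simpa only [← mulVec_mulVec, add_mulVec, one_mulVec] using hu_eq
end
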